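/- arXiv:2002.01518 — 2 statements merged into one kernel-verified Lean document; each statement's English description precedes it below -/
import Mathlib

section
/- Let (p̃_n(x))_{n≥0} be the orthogonal polynomials over the polynomial ring in commuting indeterminates X₀, X₁, …, Y₀, Y₁, … defined by p̃_{−1}=0, p̃_0=1 and p̃_{n+1}(x) = (x + (X_n + Y_n)) p̃_n(x) − (Y_{n−1} X_n) p̃_{n−1}(x). Then the coefficient of x^n in p̃_{n+k}(x) equals Σ_{μ ⊆ (k)×(2n+1)} w(μ), the sum over all partitions μ with at most k parts, each part of size at most 2n+1, where for μ = (μ₁ ≥ ⋯ ≥ μ_l ≥ 0) (padded with zeros to length l = k), w(μ) = ∏_{i=1}^{l} Z_{μ_{l+1−i}+2(i−1)}. -/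
noncomputable section

open Finset

/-- The polynomial ring `ℤ[X₀, X₁, …, Y₀, Y₁, …]` in independent commuting
indeterminates: `Sum.inl i ↦ X_i`, `Sum.inr i ↦ Y_i`. -/
abbrev S : Type := MvPolynomial (ℕ ⊕ ℕ) ℤ

def XX (i : ℕ) : S := MvPolynomial.X (Sum.inl i)
def YY (i : ℕ) : S := MvPolynomial.X (Sum.inr i)

/-- `Z_m = X_{⌊m/2⌋}` if `m` is even, `Y_{⌊m/2⌋}` if `m` is odd. -/
def ZZ (m : ℕ) : S := if m % 2 = 0 then XX (m / 2) else YY (m / 2)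

/-- The orthogonal polynomials `p̃_n` defined by `p̃₋₁ = 0`, `p̃₀ = 1` and
`p̃_{n+1}(x) = (x + (X_n + Y_n)) p̃_n(x) − (Y_{n−1} X_n) p̃_{n−1}(x)`. -/
def ptilde : ℕ → Polynomial S
  | 0 => 1
  | 1 => Polynomial.X + Polynomial.C (XX 0 + YY 0)
  | n + 2 => (Polynomial.X + Polynomial.C (XX (n + 1) + YY (n + 1))) * ptilde (n + 1)
      - Polynomial.C (YY n * XX (n + 1)) * ptilde n

/-- A partition with (at most) `l` parts, each `< c`, encoded as a function `Fin l → Fin c`,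
extended to a function `ℕ → ℕ` by padding with zeros. -/
def extFn {l c : ℕ} (μ : Fin l → Fin c) : ℕ → ℕ :=
  fun j => if h : j < l then (μ ⟨j, h⟩ : ℕ) else 0

/-- The weight `w(μ) = ∏_{i=1}^{l} Z_{μ_{l+1−i}+2(i−1)}` of a partition `μ` with `l` parts
(`μ 0 = μ₁` is the largest part). -/
def wweight (l : ℕ) (μ : ℕ → ℕ) : S :=
  ∏ i ∈ Finset.range l, ZZ (μ (l - 1 - i) + 2 * i)

/-- The recursive form of the weighted count. -/
def RR : ℕ → ℕ → S
  | 0, _ => 1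
  | _ + 1, 0 => 0
  | k + 1, c + 1 => RR (k + 1) c + ZZ (c + 2 * k) * RR k (c + 1)

lemma RR_zero (c : ℕ) : RR 0 c = 1 := by cases c <;> simp [RR]

lemma RR_succ (k c : ℕ) : RR (k + 1) (c + 1) = RR (k + 1) c + ZZ (c + 2 * k) * RR k (c + 1) := by
  simp [RR]

lemma ZZ_even (m : ℕ) : ZZ (2 * m) = XX m := by simp [ZZ]

lemma ZZ_odd (m : ℕ) : ZZ (2 * m + 1) = YY m := by
  have h1 : (2 * m + 1) % 2 = 1 := by omega
  have h2 : (2 * m + 1) / 2 = m := by omega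
  simp [ZZ, h1, h2]

lemma RR_one (c : ℕ) :
    RR 1 (2 * c + 2) = RR 1 (2 * c) + XX c + YY c := by
  have e1 := RR_succ 0 (2 * c + 1)
  have e2 := RR_succ 0 (2 * c)
  simp only [RR_zero, mul_zero, add_zero, zero_add, ZZ_even, ZZ_odd] at e1 e2
  rw [e1, e2]; ring

lemma RR_three (k c : ℕ) :
    RR (k + 2) (2 * c + 2) = RR (k + 2) (2 * c)
      + (XX (c + k + 1) + YY (c + k + 1)) * RR (k + 1) (2 * c + 2)
      - YY (c + k) * XX (c + k + 1) * RR k (2 * c + 2) := by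
  have e1 := RR_succ (k + 1) (2 * c + 1)
  have e2 := RR_succ (k + 1) (2 * c)
  have e3 := RR_succ k (2 * c + 1)
  rw [show 2 * c + 1 + 2 * (k + 1) = 2 * (c + k + 1) + 1 by ring, ZZ_odd] at e1
  rw [show 2 * c + 2 * (k + 1) = 2 * (c + k + 1) by ring, ZZ_even] at e2
  rw [show 2 * c + 1 + 2 * k = 2 * (c + k) + 1 by ring, ZZ_odd] at e3
  simp only [add_assoc, Nat.reduceAdd] at e1 e2 e3 ⊢
  rw [e1, e2, e3]; ring

lemma coeff_rec_zero (m : ℕ) : (ptilde (m + 2)).coeff 0 =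
    (XX (m + 1) + YY (m + 1)) * (ptilde (m + 1)).coeff 0
      - YY m * XX (m + 1) * (ptilde m).coeff 0 := by
  rw [ptilde, add_mul, Polynomial.coeff_sub, Polynomial.coeff_add, Polynomial.coeff_C_mul,
    Polynomial.coeff_C_mul, Polynomial.coeff_X_mul_zero, zero_add]

lemma coeff_rec_succ (m n : ℕ) : (ptilde (m + 2)).coeff (n + 1) =
    (ptilde (m + 1)).coeff n + (XX (m + 1) + YY (m + 1)) * (ptilde (m + 1)).coeff (n + 1)
      - YY m * XX (m + 1) * (ptilde m).coeff (n + 1) := by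
  rw [ptilde, add_mul, Polynomial.coeff_sub, Polynomial.coeff_add, Polynomial.coeff_C_mul,
    Polynomial.coeff_C_mul, Polynomial.coeff_X_mul]

lemma coeff_ptilde_eq (m : ℕ) : ∀ n, (m < n → (ptilde m).coeff n = 0) ∧
    ∀ k, n + k = m → (ptilde m).coeff n = RR k (2 * n + 2) := by
  induction m using Nat.strong_induction_on with
  | _ m ih =>
    match m, ih with
    | 0, _ =>
      intro n
      refine ⟨fun h => ?_, fun k h => ?_⟩
      · simp [ptilde, Polynomial.coeff_one, h.ne']
      · obtain ⟨rfl, rfl⟩ : n = 0 ∧ k = 0 := by omega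
        simp [ptilde, RR_zero]
    | 1, _ =>
      intro n
      refine ⟨fun h => ?_, fun k h => ?_⟩
      · rw [ptilde, Polynomial.coeff_add, Polynomial.coeff_X, Polynomial.coeff_C]
        rw [if_neg (by omega), if_neg (by omega), add_zero]
      · obtain ⟨rfl, rfl⟩ | ⟨rfl, rfl⟩ : (n = 0 ∧ k = 1) ∨ (n = 1 ∧ k = 0) := by omega
        · rw [RR_one 0, ptilde, Polynomial.coeff_add, Polynomial.coeff_X, Polynomial.coeff_C]
          simp [RR]
        · rw [ptilde, Polynomial.coeff_add, Polynomial.coeff_X, Polynomial.coeff_C]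
          simp [RR_zero]
    | m + 2, ih =>
      have h1 := ih (m + 1) (by omega)
      have h0 := ih m (by omega)
      intro n
      cases n with
      | zero =>
        refine ⟨fun h => by omega, fun k h => ?_⟩
        obtain rfl : k = m + 2 := by omega
        rw [coeff_rec_zero, (h1 0).2 (m + 1) (by omega), (h0 0).2 m (by omega)]
        have := RR_three m 0
        simp only [mul_zero, zero_add] at this ⊢
        rw [this]; simp [RR]
      | succ n =>
        rw [coeff_rec_succ]
        refine ⟨fun h => ?_, fun k h => ?_⟩
        · rw [(h1 n).1 (by omega), (h1 (n + 1)).1 (by omega), (h0 (n + 1)).1 (by omega)]; ring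
        · match k, h with
          | 0, h =>
            rw [(h1 n).2 0 (by omega), (h1 (n + 1)).1 (by omega), (h0 (n + 1)).1 (by omega)]
            simp [RR_zero]
          | 1, h =>
            obtain rfl : n = m := by omega
            rw [(h1 n).2 1 (by omega), (h1 (n + 1)).2 0 (by omega), (h0 (n + 1)).1 (by omega),
              RR_one (n + 1), RR_zero, mul_add 2 n 1]; ring
          | k + 2, h =>
            obtain rfl : m = n + 1 + k := by omega
            rw [(h1 n).2 (k + 2) (by omega), (h1 (n + 1)).2 (k + 1) (by omega),
              (h0 (n + 1)).2 k (by omega), RR_three k (n + 1), mul_add 2 n 1]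

/-- The partitions with `k` parts, all `< c`, as natural-number valued functions. -/
def PP (k c : ℕ) : Finset (Fin k → ℕ) :=
  (Fintype.piFinset fun _ : Fin k => Finset.range c).filter (fun μ => Antitone μ)

lemma mem_PP {k c : ℕ} {μ : Fin k → ℕ} : μ ∈ PP k c ↔ (∀ i, μ i < c) ∧ Antitone μ := by
  simp [PP]

/-- The weight, with the product over `Fin k` from the largest part on. -/
def WW (k : ℕ) (μ : Fin k → ℕ) : S := ∏ i : Fin k, ZZ (μ i + 2 * (k - 1 - i))

lemma WW_cons (k c : ℕ) (μ : Fin k → ℕ) :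
    WW (k + 1) (Fin.cons c μ) = ZZ (c + 2 * k) * WW k μ := by
  unfold WW
  rw [Fin.prod_univ_succ]
  simp only [Fin.cons_zero, Fin.cons_succ, Fin.val_zero, Fin.val_succ]
  congr 1
  refine Finset.prod_congr rfl fun i _ => ?_
  congr 3
  omega

lemma sum_PP_succ (k c : ℕ) : ∑ μ ∈ PP (k + 1) (c + 1), WW (k + 1) μ =
    ∑ μ ∈ PP (k + 1) c, WW (k + 1) μ + ZZ (c + 2 * k) * ∑ μ ∈ PP k (c + 1), WW k μ := by
  rw [← Finset.sum_filter_add_sum_filter_not (PP (k + 1) (c + 1)) (fun μ => μ 0 < c)]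
  congr 1
  · refine Finset.sum_congr ?_ fun _ _ => rfl
    ext μ
    simp only [Finset.mem_filter, mem_PP]
    constructor
    · rintro ⟨⟨_, ha⟩, h0⟩
      exact ⟨fun i => lt_of_le_of_lt (ha (Fin.zero_le i)) h0, ha⟩
    · rintro ⟨h, ha⟩
      exact ⟨⟨fun i => (h i).trans (Nat.lt_succ_self c), ha⟩, h 0⟩
  · rw [Finset.mul_sum]
    refine Finset.sum_bij' (fun μ _ => Fin.tail μ) (fun μ _ => Fin.cons c μ) ?_ ?_ ?_ ?_ ?_
    · intro μ hμ
      simp only [Finset.mem_filter, mem_PP] at hμ ⊢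
      exact ⟨fun i => hμ.1.1 _, fun i j hij => hμ.1.2 (Fin.succ_le_succ_iff.2 hij)⟩
    · intro μ hμ
      simp only [Finset.mem_filter, mem_PP] at hμ ⊢
      refine ⟨⟨fun i => ?_, fun i j hij => ?_⟩, by simp⟩
      · cases i using Fin.cases with
        | zero => simp
        | succ i => simpa using hμ.1 i
      · cases i using Fin.cases with
        | zero =>
          cases j using Fin.cases with
          | zero => simp
          | succ j => simpa using Nat.lt_succ_iff.1 (hμ.1 j)
        | succ i =>
          cases j using Fin.cases with
          | zero => simp at hij
          | succ j => simpa using hμ.2 (Fin.succ_le_succ_iff.1 hij)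
    · intro μ hμ
      simp only [Finset.mem_filter, mem_PP] at hμ
      have h0 : c = μ 0 := by have := hμ.1.1 0; omega
      conv_lhs => rw [h0]
      exact Fin.cons_self_tail μ
    · intro μ _
      exact Fin.tail_cons _ _
    · intro μ hμ
      simp only [Finset.mem_filter, mem_PP] at hμ
      have h0 : c = μ 0 := by have := hμ.1.1 0; omega
      rw [← WW_cons]
      conv_rhs => rw [h0]
      rw [Fin.cons_self_tail μ]

lemma sum_PP (k c : ℕ) : ∑ μ ∈ PP k c, WW k μ = RR k c := by
  induction k generalizing c with
  | zero =>
    rw [RR_zero]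
    have : PP 0 c = Finset.univ := by
      ext μ
      simp only [mem_PP, Finset.mem_univ, iff_true]
      exact ⟨fun i => i.elim0, fun i => i.elim0⟩
    rw [this]
    simp [WW]
  | succ k ih =>
    induction c with
    | zero =>
      have : PP (k + 1) 0 = ∅ := by
        ext μ
        simp [mem_PP]
      rw [this]
      simp [RR]
    | succ c ihc => rw [sum_PP_succ, ihc, ih, RR_succ]

lemma wweight_ext {k c : ℕ} (μ : Fin k → Fin c) :
    wweight k (extFn μ) = WW k (fun i => (μ i : ℕ)) := by
  unfold wweight WW
  rw [← Finset.prod_range_reflect, Finset.prod_range]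
  refine Finset.prod_congr rfl fun i _ => ?_
  have h : k - 1 - (k - 1 - (i : ℕ)) = i := by omega
  rw [h]
  simp [extFn]

/-- **Proposition `prop`.** The coefficient of `x^n` in `p̃_{n+k}(x)` is the
weighted sum over all partitions contained in a `k × (2n+1)` rectangle, with weight `w`. -/
theorem motivating_coefficient_formula (n k : ℕ) :
    (ptilde (n + k)).coeff n =
      ∑ μ ∈ (Finset.univ : Finset (Fin k → Fin (2 * n + 2))).filter
          (fun μ => ∀ i j : Fin k, i ≤ j → μ j ≤ μ i),
        wweight k (extFn μ) := by
  rw [(coeff_ptilde_eq (n + k) n).2 k rfl, ← sum_PP]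
  symm
  refine Finset.sum_bij (fun μ _ i => (μ i : ℕ)) ?_ ?_ ?_ ?_
  · intro μ hμ
    rw [Finset.mem_filter] at hμ
    exact mem_PP.2 ⟨fun i => (μ i).2, fun i j hij => hμ.2 i j hij⟩
  · intro μ _ ν _ h
    funext i
    exact Fin.ext (congrFun h i)
  · intro μ hμ
    rw [mem_PP] at hμ
    refine ⟨fun i => ⟨μ i, hμ.1 i⟩, ?_, rfl⟩
    rw [Finset.mem_filter]
    exact ⟨Finset.mem_univ _, fun i j hij => hμ.2 hij⟩
  · intro μ _
    exact wweight_ext μ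
end
end

section
/- For all integers k ≥ 1 and 1 ≤ i ≤ k, the following identity holds: binom_q(k+1,i) · X_{i−1} · Y_{k−i} = binom_q(k,i−1) · X_k · Y_{k−i} + binom_q(k,i) · X_{i−1} · Y_k − λ_k · binom_q(k−1,i−1), where λ_k = Y_{k−1}X_k − α(β−ε₂)q^{k−1} (equivalently λ_k = ε₁ε₂[k]_q[k−1]_q+(αε₂+βε₁)q^{k−1}[k]_q+αβ(q^{2k−1}−q^{k−1})). -/
noncomputable section

open Finset

/-- The base ring `R = ℤ[α, β, ε₁, ε₂, q]`, with variables
`av = α`, `bv = β`, `e1v = ε₁`, `e2v = ε₂`, `qv = q`. -/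
abbrev R : Type := MvPolynomial (Fin 5) ℤ

def av : R := MvPolynomial.X 0
def bv : R := MvPolynomial.X 1
def e1v : R := MvPolynomial.X 2
def e2v : R := MvPolynomial.X 3
def qv : R := MvPolynomial.X 4

/-- `[n]_q = 1 + q + ⋯ + q^(n-1)`. -/
def qnum (n : ℕ) : R := ∑ i ∈ Finset.range n, qv ^ i

/-- The Gaussian (q-)binomial coefficient. -/
def qbinom : ℕ → ℕ → R
  | _, 0 => 1
  | 0, _ + 1 => 0
  | n + 1, k + 1 => qbinom n k + qv ^ (k + 1) * qbinom n (k + 1)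

/-- `X_i = α q^i + ε₁ [i]_q`. -/
def Xv (i : ℕ) : R := av * qv ^ i + e1v * qnum i

/-- `Y_i = β q^i + ε₂ [i]_q`. -/
def Yv (i : ℕ) : R := bv * qv ^ i + e2v * qnum i

/-- `b_n = (α+β) q^n + (ε₁+ε₂)[n]_q`. -/
def bcoef (n : ℕ) : R := (av + bv) * qv ^ n + (e1v + e2v) * qnum n

/-- `λ_n = ε₁ε₂[n]_q[n-1]_q + (αε₂+βε₁) q^(n-1) [n]_q + αβ(q^(2n-1) - q^(n-1))` (for `n ≥ 1`). -/
def lcoef (n : ℕ) : R :=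
  e1v * e2v * qnum n * qnum (n - 1) + (av * e2v + bv * e1v) * qv ^ (n - 1) * qnum n
    + av * bv * (qv ^ (2 * n - 1) - qv ^ (n - 1))

/-- The transformed Al-Salam-Chihara polynomials. -/
def phat : ℕ → Polynomial R
  | 0 => 1
  | 1 => Polynomial.X + Polynomial.C (bcoef 0)
  | n + 2 => (Polynomial.X + Polynomial.C (bcoef (n + 1))) * phat (n + 1)
      - Polynomial.C (lcoef (n + 1)) * phat n

/-- `g m i` is the coefficient of `x^i` in `p̂_m(x)`. -/
def g (m i : ℕ) : R := (phat m).coeff i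

theorem qnum_s (n : ℕ) : qnum (n + 1) = qnum n + qv ^ n := by
  simp [qnum, Finset.sum_range_succ]

theorem qnum_geom (n : ℕ) : qv ^ n = 1 - (1 - qv) * qnum n := by
  induction n with
  | zero => simp [qnum]
  | succ n ih => rw [qnum_s, pow_succ]; linear_combination ih

theorem qnum_s' (n : ℕ) : qnum (n + 1) = 1 + qv * qnum n := by
  rw [qnum_s]; linear_combination qnum_geom n

theorem qnum_add (a b : ℕ) : qnum (a + b) = qnum a + qv ^ a * qnum b := by
  induction b with
  | zero => simp [qnum]
  | succ b ih => rw [← add_assoc, qnum_s, qnum_s, ih, pow_add]; ring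

theorem qbinom_z (n : ℕ) : qbinom n 0 = 1 := by
  cases n <;> simp [qbinom]

theorem qbinom_ss (n k : ℕ) :
    qbinom (n + 1) (k + 1) = qbinom n k + qv ^ (k + 1) * qbinom n (k + 1) := by
  simp [qbinom]

theorem qbinom_S (n : ℕ) : ∀ j, qnum (j + 1) * qbinom (n + 1) (j + 1) =
    qnum (n + 1) * qbinom n j := by
  induction n with
  | zero =>
    intro j
    cases j <;> simp [qbinom]
  | succ n ih =>
    intro j
    cases j with
    | zero =>
      have h := ih 0
      rw [qbinom_ss (n + 1) 0, qbinom_z, qnum_s' (n + 1)]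
      rw [qbinom_z] at h
      have h1 : qnum (0 + 1) = 1 := by simp [qnum]
      rw [h1] at h ⊢
      linear_combination qv * h
    | succ l =>
      have h1 := ih l
      have h2 := ih (l + 1)
      have h3 := qbinom_ss n l
      rw [qbinom_ss (n + 1) (l + 1), qnum_s' (n + 1)]
      have h4 := qnum_s' (l + 1)
      linear_combination qv ^ (l + 2) * h2 + qbinom (n + 1) (l + 1) * h4 + qv * h1
        - qv * qnum (n + 1) * h3

theorem qbinom_T (j m : ℕ) : qnum (j + 1) * qbinom (j + m) (j + 1) =
    qnum m * qbinom (j + m) j := by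
  have hq : qv ^ (j + 1) ≠ 0 := pow_ne_zero _ (MvPolynomial.X_ne_zero _)
  apply mul_left_cancel₀ hq
  have h := qbinom_S (j + m) j
  rw [qbinom_ss, show j + m + 1 = (j + 1) + m by ring, qnum_add (j + 1) m] at h
  linear_combination h

theorem qbinom_U (j m : ℕ) : qnum (m + 1) * qbinom (j + m + 1) j =
    qnum (j + m + 1) * qbinom (j + m) j := by
  rw [← qbinom_S]
  exact (qbinom_T j (m + 1)).symm

/-- **Lemma `lem`.** For `k ≥ 1` and `1 ≤ i ≤ k`,
`binom_q(k+1,i) X_{i−1} Y_{k−i} = binom_q(k,i−1) X_k Y_{k−i} + binom_q(k,i) X_{i−1} Y_k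
  − λ_k binom_q(k−1,i−1)`, where `λ_k = Y_{k−1}X_k − α(β−ε₂)q^{k−1}`. -/
theorem key_lemma_identity (k i : ℕ) (hk : 1 ≤ k) (hi1 : 1 ≤ i) (hik : i ≤ k) :
    qbinom (k + 1) i * Xv (i - 1) * Yv (k - i) =
      qbinom k (i - 1) * Xv k * Yv (k - i) + qbinom k i * Xv (i - 1) * Yv k
        - (Yv (k - 1) * Xv k - av * (bv - e2v) * qv ^ (k - 1)) * qbinom (k - 1) (i - 1) := by
  obtain ⟨j, rfl⟩ : ∃ j, i = j + 1 := ⟨i - 1, by omega⟩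
  obtain ⟨m, rfl⟩ : ∃ m, k = j + m + 1 := ⟨k - (j + 1), by omega⟩
  have e1 : j + m + 1 - (j + 1) = m := by omega
  simp only [e1, Nat.add_sub_cancel]
  have hS := qbinom_S (j + m) j
  have hU := qbinom_U j m
  rw [qbinom_ss (j + m + 1) j]
  generalize qbinom (j + m + 1) j = P at *
  generalize qbinom (j + m + 1) (j + 1) = Q at *
  generalize qbinom (j + m) j = A at *
  have hX : Xv (j + m + 1) = qv ^ (m + 1) * Xv j + e1v * qnum (m + 1) := by
    have := qnum_add (m + 1) j
    rw [show m + 1 + j = j + m + 1 by ring] at this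
    simp only [Xv, this]; ring
  have hY : Yv (j + m + 1) = qv ^ (j + 1) * Yv m + e2v * qnum (j + 1) := by
    have := qnum_add (j + 1) m
    rw [show j + 1 + m = j + m + 1 by ring] at this
    simp only [Yv, this]; ring
  have hg := qnum_geom (m + 1)
  have key : (1 - qv) * qnum (j + m + 1) * Xv j * Yv m
      - qnum (j + m + 1) * (e1v * Yv m + e2v * Xv j)
      = - (Yv (j + m) * Xv (j + m + 1) - av * (bv - e2v) * qv ^ (j + m)) := by
    simp only [Xv, Yv, qnum_s', qnum_add, pow_succ, pow_add]
    rw [qnum_geom j, qnum_geom m]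
    ring
  have hX' : P * Xv (j + m + 1) = qv ^ (m + 1) * P * Xv j + e1v * (qnum (j + m + 1) * A) := by
    rw [hX]; linear_combination e1v * hU
  have hY' : Q * Yv (j + m + 1) = qv ^ (j + 1) * Q * Yv m + e2v * (qnum (j + m + 1) * A) := by
    rw [hY]; linear_combination e2v * hS
  linear_combination A * key - Yv m * hX' - Xv j * hY' - P * Xv j * Yv m * hg
    + (1 - qv) * Xv j * Yv m * hU
end
end
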